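/- Let A be the companion matrix of f(x) = (x-1)^5 and B the companion matrix of g(x) = (x+1)³(x²−x+1), and set T = B·A⁻¹ in GL(5,ℚ). Then T² = I with T ≠ I, B has infinite order, and the hypergeometric group Γ(f,g) = ⟨A,B⟩ is the free product of the subgroup generated by T and the subgroup generated by B: the canonical group homomorphism from the abstract free product (ℤ/2ℤ) ∗ ℤ to GL(5,ℚ) sending the generator of ℤ/2ℤ to T and the generator of ℤ to B is injective with image Γ(f,g). -/

import Mathlib

open Polynomial Matrix

/-- The companion matrix of a monic degree-5 rational polynomial `p`:
the `5 × 5` matrix whose entries in position `(i+1, i)` equal `1` for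
`i = 1, ..., 4`, whose last column is `(-p₀, -p₁, -p₂, -p₃, -p₄)ᵀ`
(where `pᵢ` is the coefficient of `xⁱ` in `p`), and whose remaining
entries are `0`. -/
def companionMatrix (p : ℚ[X]) : Matrix (Fin 5) (Fin 5) ℚ :=
  Matrix.of fun i j : Fin 5 =>
    if (j : ℕ) = 4 then -p.coeff i
    else if (i : ℕ) = (j : ℕ) + 1 then 1 else 0

open scoped Pointwise in
/-- The ping-pong lemma for the free product of two groups given as a family over `Bool`. -/
theorem Monoid.Coprod.lift_injective_of_ping_pong_family {F : Bool → Type*} [∀ i, Group (F i)]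
    {K α : Type*} [Group K] [MulAction K α] (φ : ∀ i, F i →* K)
    (hF : 3 ≤ Cardinal.mk (F false)) {X Y : Set α}
    (hX : X.Nonempty) (hY : Y.Nonempty) (hXY : Disjoint X Y)
    (hf : ∀ a, a ≠ 1 → ∀ y ∈ Y, φ true a • y ∈ X)
    (hg : ∀ b, b ≠ 1 → ∀ x ∈ X, φ false b • x ∈ Y) :
    Function.Injective (Monoid.Coprod.lift (φ true) (φ false)) := by
  have hφ : Function.Injective (Monoid.CoprodI.lift φ) := by
    refine Monoid.CoprodI.lift_injective_of_ping_pong φ (Or.inr ⟨false, hF⟩)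
      (fun i => cond i X Y) ?_ ?_ ?_
    · rintro (_ | _)
      exacts [hY, hX]
    · rintro (_ | _) (_ | _) hij
      exacts [absurd rfl hij, hXY.symm, hXY, absurd rfl hij]
    · rintro (_ | _) (_ | _) hij h hh
      · exact absurd rfl hij
      · exact Set.smul_set_subset_iff.2 fun x hx => hg h hh x hx
      · exact Set.smul_set_subset_iff.2 fun y hy => hf h hh y hy
      · exact absurd rfl hij
  let toFamily : Monoid.Coprod (F true) (F false) →* Monoid.CoprodI F :=
    Monoid.Coprod.lift Monoid.CoprodI.of Monoid.CoprodI.of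
  let ofFamily : Monoid.CoprodI F →* Monoid.Coprod (F true) (F false) :=
    Monoid.CoprodI.lift fun i => match i with
      | true => Monoid.Coprod.inl
      | false => Monoid.Coprod.inr
  have hcomp : ofFamily.comp toFamily = MonoidHom.id _ := by
    ext x <;> simp [toFamily, ofFamily]
  have hlift : Monoid.Coprod.lift (φ true) (φ false) =
      (Monoid.CoprodI.lift φ).comp toFamily := by
    ext x <;> simp [toFamily]
  rw [hlift, MonoidHom.coe_comp]
  exact hφ.comp (Function.LeftInverse.injective (DFunLike.congr_fun hcomp))

/-- The ping-pong lemma for the free product of two groups, the second of which has at least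
three elements. -/
theorem Monoid.Coprod.lift_injective_of_ping_pong.{u, v, w} {G H : Type u} {K : Type v}
    {α : Type w} [hG : Group G] [hH : Group H] [Group K] [MulAction K α] (f : G →* K) (g : H →* K)
    (hcard : 3 ≤ Cardinal.mk H) {X Y : Set α}
    (hX : X.Nonempty) (hY : Y.Nonempty) (hXY : Disjoint X Y)
    (hf : ∀ a, a ≠ 1 → ∀ y ∈ Y, f a • y ∈ X) (hg : ∀ b, b ≠ 1 → ∀ x ∈ X, g b • x ∈ Y) :
    Function.Injective (Monoid.Coprod.lift f g) :=
  @Monoid.Coprod.lift_injective_of_ping_pong_family (fun i => Bool.rec H G i)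
    (fun i => Bool.rec hH hG i) K α _ _ (fun i => Bool.rec g f i) hcard X Y hX hY hXY hf hg

/-- If `g` maps `X ∪ Y` into `Y`, then so does every positive power of `g`. -/
theorem pow_succ_smul_mem_of_smul_mem {M α : Type*} [Monoid M] [MulAction M α] {g : M}
    {X Y : Set α} (hg : ∀ x ∈ X ∪ Y, g • x ∈ Y) {x : α} (hx : x ∈ X ∪ Y) (n : ℕ) :
    g ^ (n + 1) • x ∈ Y := by
  induction n with
  | zero => simpa using hg x hx
  | succ n ih => rw [pow_succ', mul_smul]; exact hg _ (Or.inr ih)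

namespace HypergeometricCone

/-- The reflection `T` in coordinates. -/
def actT (v : Fin 5 → ℚ) : Fin 5 → ℚ :=
  ![-v 0, 3 * v 0 + v 1, -11 * v 0 + v 2, 9 * v 0 + v 3, -7 * v 0 + v 4]

/-- The companion matrix `B` in coordinates. -/
def actB (v : Fin 5 → ℚ) : Fin 5 → ℚ :=
  ![-v 4, v 0 - 2 * v 4, v 1 - v 4, v 2 - v 4, v 3 - 2 * v 4]

/-- The inverse of `B` in coordinates. -/
def actBInv (v : Fin 5 → ℚ) : Fin 5 → ℚ :=
  ![v 1 - 2 * v 0, v 2 - v 0, v 3 - v 0, v 4 - 2 * v 0, -v 0]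

/-- An involution that commutes with `T` and conjugates `B` to its inverse. -/
def mirror (v : Fin 5 → ℚ) : Fin 5 → ℚ :=
  ![v 0, 2 * v 0 - v 4, v 0 - v 3, v 0 - v 2, 2 * v 0 - v 1]

theorem actT_neg (v : Fin 5 → ℚ) : actT (-v) = -actT v := by
  ext i; fin_cases i <;> simp [actT] <;> ring

theorem actBInv_neg (v : Fin 5 → ℚ) : actBInv (-v) = -actBInv v := by
  ext i; fin_cases i <;> simp [actBInv] <;> ring

theorem mirror_neg (v : Fin 5 → ℚ) : mirror (-v) = -mirror v := by
  ext i; fin_cases i <;> simp [mirror] <;> ring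

theorem actT_actT (v : Fin 5 → ℚ) : actT (actT v) = v := by
  ext i; fin_cases i <;> simp [actT]

theorem actB_actBInv (v : Fin 5 → ℚ) : actB (actBInv v) = v := by
  ext i; fin_cases i <;> simp [actB, actBInv]

theorem mirror_mirror (v : Fin 5 → ℚ) : mirror (mirror v) = v := by
  ext i; fin_cases i <;> simp [mirror]

theorem actT_mirror (v : Fin 5 → ℚ) : actT (mirror v) = mirror (actT v) := by
  ext i; fin_cases i <;> simp [actT, mirror] <;> ring

theorem mirror_actB (v : Fin 5 → ℚ) : mirror (actB v) = actBInv (mirror v) := by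
  ext i; fin_cases i <;> simp [actB, actBInv, mirror] <;> ring

/-- The open polyhedral cone on which ping-pong is played. -/
def cone : Set (Fin 5 → ℚ) :=
  {v | 0 < 7 * v 0 - v 1 - v 2 - v 3 - v 4 ∧
    0 < 21 * v 0 + 5 * v 1 - 3 * v 2 - 11 * v 3 - 11 * v 4 ∧
    0 < 6 * v 0 + v 1 + 2 * v 2 + v 3 - 2 * v 4 ∧
    0 < 31 * v 0 + v 1 - v 2 + v 3 - v 4 ∧
    0 < -18 * v 0 + v 1 - v 3 + 2 * v 4 ∧
    0 < 26 * v 0 - 5 * v 1 - 2 * v 2 + 3 * v 3 + 2 * v 4 ∧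
    0 < -5 * v 0 - 3 * v 1 - v 2 + v 3 + 3 * v 4}

theorem actT_actBInv_mem_cone_of_mem {v : Fin 5 → ℚ} (hv : v ∈ cone) :
    actT (actBInv v) ∈ cone := by
  simp [cone, actT, actBInv] at hv ⊢
  refine ⟨?_, ?_, ?_, ?_, ?_, ?_, ?_⟩ <;> linarith

theorem actT_actBInv_mem_cone_of_mirror_mem {v : Fin 5 → ℚ} (hv : mirror v ∈ cone) :
    actT (actBInv v) ∈ cone := by
  simp [cone, actT, actBInv, mirror] at hv ⊢
  refine ⟨?_, ?_, ?_, ?_, ?_, ?_, ?_⟩ <;> linarith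

theorem actT_actBInv_mem_cone_of_neg_actT_mem {v : Fin 5 → ℚ} (hv : -actT v ∈ cone) :
    actT (actBInv v) ∈ cone := by
  simp [cone, actT, actBInv] at hv ⊢
  refine ⟨?_, ?_, ?_, ?_, ?_, ?_, ?_⟩ <;> linarith

/-- The union of the cone and its negative. -/
def doubleCone : Set (Fin 5 → ℚ) := {v | v ∈ cone ∨ -v ∈ cone}

/-- The vectors that the negative powers of `B` produce from `mirrorCone`. -/
def negSet : Set (Fin 5 → ℚ) := {v | actT v ∈ doubleCone}

/-- The vectors that the positive powers of `B` produce from `mirrorCone`. -/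
def posSet : Set (Fin 5 → ℚ) := {v | mirror v ∈ negSet}

/-- The union of the double cone and its mirror image. -/
def mirrorCone : Set (Fin 5 → ℚ) := {v | v ∈ doubleCone ∨ mirror v ∈ doubleCone}

theorem mirror_mem_mirrorCone {v : Fin 5 → ℚ} (hv : v ∈ mirrorCone) : mirror v ∈ mirrorCone := by
  rw [mirrorCone, Set.mem_ofPred_eq, mirror_mirror]
  exact hv.symm

theorem actBInv_mem_negSet {v : Fin 5 → ℚ} (hv : v ∈ mirrorCone ∪ negSet) :
    actBInv v ∈ negSet := by
  rcases hv with ((hv | hv) | hv | hv) | hv | hv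
  · exact Or.inl (actT_actBInv_mem_cone_of_mem hv)
  · exact Or.inr (by simpa [actT_neg, actBInv_neg] using actT_actBInv_mem_cone_of_mem hv)
  · exact Or.inl (actT_actBInv_mem_cone_of_mirror_mem hv)
  · rw [← mirror_neg] at hv
    exact Or.inr (by simpa [actT_neg, actBInv_neg] using actT_actBInv_mem_cone_of_mirror_mem hv)
  · rw [← neg_neg (actT v), ← actT_neg] at hv
    exact Or.inr (by simpa [actT_neg, actBInv_neg] using actT_actBInv_mem_cone_of_neg_actT_mem hv)
  · exact Or.inl (actT_actBInv_mem_cone_of_neg_actT_mem hv)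

theorem actB_mem_posSet {v : Fin 5 → ℚ} (hv : v ∈ mirrorCone ∪ posSet) : actB v ∈ posSet := by
  rw [posSet, Set.mem_ofPred_eq, mirror_actB]
  exact actBInv_mem_negSet (hv.imp mirror_mem_mirrorCone id)

theorem actT_mem_mirrorCone {v : Fin 5 → ℚ} (hv : v ∈ negSet ∪ posSet) : actT v ∈ mirrorCone := by
  refine hv.imp id fun h => ?_
  rw [← actT_mirror]
  exact h

/-- A linear form that is positive on the cone. -/
def height (v : Fin 5 → ℚ) : ℚ := v 0 - v 1 + v 2 - v 3 + v 4

/-- A linear form that changes sign under the mirror involution. -/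
def skew (v : Fin 5 → ℚ) : ℚ := -5 * v 0 + 3 * v 1 - v 2 - v 3 + 3 * v 4

theorem abs_skew_lt_of_mem_cone {v : Fin 5 → ℚ} (hv : v ∈ cone) :
    |skew v| < height v := by
  simp [cone] at hv
  rw [abs_lt]
  constructor <;> simp only [skew, height] <;> linarith

theorem height_lt_of_neg_actT_mem_cone {v : Fin 5 → ℚ} (hv : -actT v ∈ cone) :
    0 < height v ∧ height v < -skew v := by
  simp [cone, actT] at hv
  constructor <;> simp only [skew, height] <;> linarith

theorem height_neg (v : Fin 5 → ℚ) : height (-v) = -height v := by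
  simp [height]; ring

theorem skew_neg (v : Fin 5 → ℚ) : skew (-v) = -skew v := by
  simp [skew]; ring

theorem height_mirror (v : Fin 5 → ℚ) : height (mirror v) = height v := by
  simp [height, mirror]; ring

theorem skew_mirror (v : Fin 5 → ℚ) : skew (mirror v) = -skew v := by
  simp [skew, mirror]; ring

theorem abs_skew_lt_of_mem_mirrorCone {v : Fin 5 → ℚ} (hv : v ∈ mirrorCone) :
    |skew v| < |height v| := by
  rcases hv with (hv | hv) | hv | hv <;>
    simpa [skew_neg, height_neg, skew_mirror, height_mirror] using
      (abs_skew_lt_of_mem_cone hv).trans_le (le_abs_self _)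

theorem abs_height_lt_of_mem_negSet {v : Fin 5 → ℚ} (hv : v ∈ negSet) :
    |height v| < |skew v| := by
  rcases hv with hv | hv
  · rw [← neg_neg (actT v), ← actT_neg] at hv
    obtain ⟨h₀, h₁⟩ := height_lt_of_neg_actT_mem_cone hv
    rw [← abs_neg (height v), ← height_neg, abs_of_pos h₀, ← abs_neg (skew v), ← skew_neg,
      ← abs_neg]
    exact h₁.trans_le (le_abs_self _)
  · obtain ⟨h₀, h₁⟩ := height_lt_of_neg_actT_mem_cone hv
    rw [abs_of_pos h₀, ← abs_neg]
    exact h₁.trans_le (le_abs_self _)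

theorem disjoint_mirrorCone : Disjoint mirrorCone (negSet ∪ posSet) := by
  refine Set.disjoint_left.2 fun v hv hv' => (abs_skew_lt_of_mem_mirrorCone hv).not_gt ?_
  rcases hv' with hv' | hv'
  · exact abs_height_lt_of_mem_negSet hv'
  · simpa [height_mirror, skew_mirror] using abs_height_lt_of_mem_negSet hv'

theorem mirrorCone_nonempty : mirrorCone.Nonempty :=
  ⟨![7, -17, 68, -63, 45], Or.inl (Or.inl (by simp [cone]; norm_num))⟩

theorem companionMatrix_sub_one_pow_five : companionMatrix ((X - 1) ^ 5) =
    !![0, 0, 0, 0, 1; 1, 0, 0, 0, -5; 0, 1, 0, 0, 10; 0, 0, 1, 0, -10; 0, 0, 0, 1, 5] := by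
  have h : ((X - 1) ^ 5 : ℚ[X]) =
      X ^ 5 - C 5 * X ^ 4 + C 10 * X ^ 3 - C 10 * X ^ 2 + C 5 * X - C 1 := by
    simp only [map_ofNat, map_one]; ring
  rw [h]
  ext i j
  fin_cases i <;> fin_cases j <;> simp [companionMatrix, coeff_X, coeff_one, coeff_X_pow]

theorem companionMatrix_add_one_pow_three_mul :
    companionMatrix ((X + 1) ^ 3 * (X ^ 2 - X + 1)) =
    !![0, 0, 0, 0, -1; 1, 0, 0, 0, -2; 0, 1, 0, 0, -1; 0, 0, 1, 0, -1; 0, 0, 0, 1, -2] := by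
  have h : ((X + 1) ^ 3 * (X ^ 2 - X + 1) : ℚ[X]) =
      X ^ 5 + C 2 * X ^ 4 + X ^ 3 + X ^ 2 + C 2 * X + C 1 := by
    simp only [map_ofNat, map_one]; ring
  rw [h]
  ext i j
  fin_cases i <;> fin_cases j <;> simp [companionMatrix, coeff_X, coeff_one, coeff_X_pow]

theorem coe_mul_inv_eq {A B : GL (Fin 5) ℚ}
    (hA : (↑A : Matrix (Fin 5) (Fin 5) ℚ) = companionMatrix ((X - 1) ^ 5))
    (hB : (↑B : Matrix (Fin 5) (Fin 5) ℚ) = companionMatrix ((X + 1) ^ 3 * (X ^ 2 - X + 1))) :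
    (↑(B * A⁻¹) : Matrix (Fin 5) (Fin 5) ℚ) =
      !![-1, 0, 0, 0, 0; 3, 1, 0, 0, 0; -11, 0, 1, 0, 0; 9, 0, 0, 1, 0; -7, 0, 0, 0, 1] := by
  rw [companionMatrix_sub_one_pow_five] at hA
  rw [companionMatrix_add_one_pow_three_mul] at hB
  rw [Units.val_mul, Units.mul_inv_eq_iff_eq_mul, hA, hB]
  ext i j
  fin_cases i <;> fin_cases j <;> simp [Matrix.mul_apply, Fin.sum_univ_five] <;> norm_num

theorem mulVec_eq_actT {T : GL (Fin 5) ℚ} (hT : (↑T : Matrix (Fin 5) (Fin 5) ℚ) =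
      !![-1, 0, 0, 0, 0; 3, 1, 0, 0, 0; -11, 0, 1, 0, 0; 9, 0, 0, 1, 0; -7, 0, 0, 0, 1])
    (v : Fin 5 → ℚ) : (↑T : Matrix (Fin 5) (Fin 5) ℚ) *ᵥ v = actT v := by
  rw [hT]
  ext i
  fin_cases i <;> simp [Matrix.mulVec, dotProduct, Fin.sum_univ_five, actT]

theorem mulVec_eq_actB {B : GL (Fin 5) ℚ}
    (hB : (↑B : Matrix (Fin 5) (Fin 5) ℚ) = companionMatrix ((X + 1) ^ 3 * (X ^ 2 - X + 1)))
    (v : Fin 5 → ℚ) : (↑B : Matrix (Fin 5) (Fin 5) ℚ) *ᵥ v = actB v := by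
  rw [hB, companionMatrix_add_one_pow_three_mul]
  ext i
  fin_cases i <;> simp [Matrix.mulVec, dotProduct, Fin.sum_univ_five, actB] <;> ring

end HypergeometricCone

open HypergeometricCone

/-- `GL (Fin 5) ℚ` acts on column vectors by multiplication. -/
abbrev mulVecAction : MulAction (GL (Fin 5) ℚ) (Fin 5 → ℚ) where
  smul g v := (↑g : Matrix (Fin 5) (Fin 5) ℚ) *ᵥ v
  one_smul v := Matrix.one_mulVec v
  mul_smul g h v := (Matrix.mulVec_mulVec v (↑g : Matrix (Fin 5) (Fin 5) ℚ) ↑h).symm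

/-- An element of square one determines a homomorphism from the group of order two. -/
def zmodTwoHom {K : Type*} [Group K] (T : K) (hT : T ^ 2 = 1) :
    Multiplicative (ZMod 2) →* K :=
  AddMonoidHom.toMultiplicativeLeft (ZMod.lift 2 ⟨zmultiplesHom _ (Additive.ofMul T),
    congrArg Additive.ofMul ((zpow_natCast T 2).trans hT)⟩)

theorem zmodTwoHom_ofAdd_one {K : Type*} [Group K] (T : K) (hT : T ^ 2 = 1) :
    zmodTwoHom T hT (Multiplicative.ofAdd 1) = T := by
  have h := ZMod.lift_coe 2 ⟨zmultiplesHom _ (Additive.ofMul T),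
    congrArg Additive.ofMul ((zpow_natCast T 2).trans hT)⟩ 1
  simp at h
  exact congrArg Additive.toMul h

theorem lift_zmodTwoHom_zpowersHom_injective {B T : GL (Fin 5) ℚ} (hT2 : T ^ 2 = 1)
    (hT : ∀ v, (↑T : Matrix (Fin 5) (Fin 5) ℚ) *ᵥ v = actT v)
    (hB : ∀ v, (↑B : Matrix (Fin 5) (Fin 5) ℚ) *ᵥ v = actB v) :
    Function.Injective (Monoid.Coprod.lift (zmodTwoHom T hT2) (zpowersHom _ B)) := by
  let := mulVecAction
  have hBact (v) : B • v = actB v := hB v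
  have hBinv (v) : B⁻¹ • v = actBInv v := by
    rw [inv_smul_eq_iff]
    rw [hBact, actB_actBInv]
  have hTact (v) : T • v = actT v := hT v
  have hpos : ∀ v ∈ mirrorCone ∪ posSet, B • v ∈ posSet := fun v hv =>
    (hBact v).symm ▸ actB_mem_posSet hv
  have hneg : ∀ v ∈ mirrorCone ∪ negSet, B⁻¹ • v ∈ negSet := fun v hv =>
    (hBinv v).symm ▸ actBInv_mem_negSet hv
  have hzpow : ∀ n : ℤ, n ≠ 0 → ∀ v ∈ mirrorCone, B ^ n • v ∈ negSet ∪ posSet := by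
    rintro ((_ | n) | n) hn v hv
    · exact absurd rfl hn
    · rw [Int.ofNat_eq_natCast, zpow_natCast]
      exact Or.inr (pow_succ_smul_mem_of_smul_mem hpos (Or.inl hv) n)
    · rw [zpow_negSucc, ← inv_pow]
      exact Or.inl (pow_succ_smul_mem_of_smul_mem hneg (Or.inl hv) n)
  refine Monoid.Coprod.lift_injective_of_ping_pong _ _
    ((Cardinal.ofNat_lt_aleph0.le).trans (Cardinal.aleph0_le_mk _)) mirrorCone_nonempty ?_
    disjoint_mirrorCone (fun a ha v hv => ?_) (fun b hb v hv => ?_)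
  · exact mirrorCone_nonempty.elim fun v hv => ⟨_, hzpow 1 one_ne_zero v hv⟩
  · have ha' : a = Multiplicative.ofAdd (1 : ZMod 2) := by
      revert a; decide
    rw [ha', zmodTwoHom_ofAdd_one]
    exact (hTact v).symm ▸ actT_mem_mirrorCone hv
  · exact hzpow b.toAdd hb v hv

/-- `Γ(f,g) = ⟨T⟩ ∗ ⟨B⟩` for `f = ((X - 1) ^ 5)`, `g = ((X + 1) ^ 3 * (X ^ 2 - X + 1))`. -/
theorem hypergeometric_free_product_case3 (A B T : GL (Fin 5) ℚ)
    (hA : (↑A : Matrix (Fin 5) (Fin 5) ℚ) = companionMatrix ((X - 1) ^ 5))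
    (hB : (↑B : Matrix (Fin 5) (Fin 5) ℚ) = companionMatrix ((X + 1) ^ 3 * (X ^ 2 - X + 1)))
    (hT : T = B * A⁻¹) :
    T ^ 2 = 1 ∧ T ≠ 1 ∧ ¬ IsOfFinOrder B ∧
    ∃ φ : Monoid.Coprod (Multiplicative (ZMod 2)) (Multiplicative ℤ) →* GL (Fin 5) ℚ,
      φ (Monoid.Coprod.inl (Multiplicative.ofAdd (1 : ZMod 2))) = T ∧
      φ (Monoid.Coprod.inr (Multiplicative.ofAdd (1 : ℤ))) = B ∧
      Function.Injective φ ∧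
      φ.range = Subgroup.closure {A, B} := by
  have hTmat := coe_mul_inv_eq hA hB
  rw [← hT] at hTmat
  have hTact := mulVec_eq_actT hTmat
  have hT2 : T ^ 2 = 1 := by
    refine Units.ext (Matrix.mulVec_injective (funext fun v => ?_))
    rw [pow_two, Units.val_mul, ← Matrix.mulVec_mulVec, hTact, hTact, actT_actT, Units.val_one,
      Matrix.one_mulVec]
  have hinj := lift_zmodTwoHom_zpowersHom_injective hT2 hTact (mulVec_eq_actB hB)
  set φ := Monoid.Coprod.lift (zmodTwoHom T hT2) (zpowersHom _ B) with hφ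
  have hφT : φ (Monoid.Coprod.inl (Multiplicative.ofAdd (1 : ZMod 2))) = T := by
    simp [hφ, zmodTwoHom_ofAdd_one]
  have hφB : φ (Monoid.Coprod.inr (Multiplicative.ofAdd (1 : ℤ))) = B := by
    simp [hφ]
  refine ⟨hT2, fun h => ?_, fun h => ?_, φ, hφT, hφB, hinj, le_antisymm ?_ ?_⟩
  · have h1 : Multiplicative.ofAdd (1 : ZMod 2) = 1 :=
      (hinj.comp Monoid.Coprod.inl_injective) (by simp [hφT, h])
    exact absurd h1 (by decide)
  · rw [← hφB, hinj.isOfFinOrder_iff, Monoid.Coprod.inr_injective.isOfFinOrder_iff,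
      isOfFinOrder_ofAdd_iff] at h
    exact not_isOfFinAddOrder_of_isAddTorsionFree one_ne_zero h
  · have hBmem : B ∈ Subgroup.closure {A, B} := Subgroup.subset_closure (by simp)
    have hTmem : T ∈ Subgroup.closure {A, B} :=
      hT ▸ mul_mem hBmem (inv_mem (Subgroup.subset_closure (by simp)))
    rw [hφ, Monoid.Coprod.range_lift, sup_le_iff]
    constructor
    · rintro _ ⟨a, rfl⟩
      have ha : a = 1 ∨ a = Multiplicative.ofAdd (1 : ZMod 2) := by
        revert a; decide
      rcases ha with rfl | rfl
      · simp
      · rwa [zmodTwoHom_ofAdd_one]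
    · rintro _ ⟨n, rfl⟩
      exact zpow_mem hBmem _
  · rw [Subgroup.closure_le]
    rintro _ (rfl | rfl)
    · have h : T⁻¹ * B ∈ φ.range := mul_mem (inv_mem ⟨_, hφT⟩) ⟨_, hφB⟩
      simpa [hT] using h
    · exact ⟨_, hφB⟩
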